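/- arXiv:2605.01830 — 2 statements merged into one kernel-verified Lean document; each statement's English description precedes it below -/
import Mathlib

section
/- Let a > 0, ψ(a) := Im(Li₂(1 + i·a)) and φ_a(b) := I(a,b) − πb/2 + b²/2 for 0 ≤ b ≤ π. Suppose 0 < ψ(a) < φ_a(π) (with φ_a(π) the limit of φ_a(b) as b → π⁻). Then there exists a unique b ∈ (0,π) such that the inverse tangent integral satisfies Ti₂(a) = arctan(a)·log(a) + I(a,b) − πb/2 + b²/2 − (π/4)·log(a² + 1). -/
open scoped Real

/-- The principal-branch dilogarithm, `Li₂(z) = −∫₀¹ Log(1 − z t)/t dt`. -/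
noncomputable def Li2 (z : ℂ) : ℂ :=
  -∫ t in (0:ℝ)..1, Complex.log (1 - z * (t : ℂ)) / (t : ℂ)

/-- The auxiliary integral `I(a,b) = ∫₀^b arctan((a + cos β)/sin β) dβ`. -/
noncomputable def I (a b : ℝ) : ℝ :=
  ∫ β in (0:ℝ)..b, Real.arctan ((a + Real.cos β) / Real.sin β)

/-- The inverse tangent integral `Ti₂(y) = ∫₀^y arctan(x)/x dx`. -/
noncomputable def Ti2 (y : ℝ) : ℝ :=
  ∫ x in (0:ℝ)..y, Real.arctan x / x

/-- The kernel whose double integral over `[0,1] × [0,a]` yields `Im Li₂(1 + i a)`. -/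
noncomputable def dilogKernel (s t : ℝ) : ℝ :=
  (1 - t) / ((1 - t) ^ 2 + s ^ 2 * t ^ 2)

lemma dilogKernel_denom_pos {s : ℝ} (hs : 0 < s) (t : ℝ) :
    0 < (1 - t) ^ 2 + s ^ 2 * t ^ 2 := by
  rcases eq_or_ne t 0 with rfl | ht
  · norm_num
  · positivity

lemma measurable_dilogKernel : Measurable (Function.uncurry dilogKernel) := by
  unfold dilogKernel Function.uncurry
  fun_prop

lemma continuous_dilogKernel_right {s : ℝ} (hs : 0 < s) : Continuous (dilogKernel s) := by
  unfold dilogKernel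
  exact Continuous.div (by fun_prop) (by fun_prop) fun t => (dilogKernel_denom_pos hs t).ne'

lemma integral_dilogKernel_right {s : ℝ} (hs : 0 < s) :
    ∫ t in (0:ℝ)..1, dilogKernel s t = (π / 2 * s - Real.log s) / (1 + s ^ 2) := by
  have hs2 : 0 < 1 + s ^ 2 := by positivity
  have key : ∀ t ∈ Set.uIcc (0:ℝ) 1, HasDerivAt
      (fun t => -Real.log ((1 - t) ^ 2 + s ^ 2 * t ^ 2) / (2 * (1 + s ^ 2))
        + s / (1 + s ^ 2) * Real.arctan (((1 + s ^ 2) * t - 1) / s)) (dilogKernel s t) t := by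
    intro t _
    have hD := dilogKernel_denom_pos hs t
    have h1 : HasDerivAt (fun t : ℝ => (1 - t) ^ 2 + s ^ 2 * t ^ 2)
        (2 * (1 - t) * (-1) + s ^ 2 * (2 * t)) t := by
      refine ((((hasDerivAt_id t).const_sub 1).pow 2).add
        (((hasDerivAt_id t).pow 2).const_mul (s ^ 2))).congr_deriv ?_
      simp
    have h2 : HasDerivAt (fun t : ℝ => ((1 + s ^ 2) * t - 1) / s) ((1 + s ^ 2) / s) t := by
      simpa using (((hasDerivAt_id t).const_mul (1 + s ^ 2)).sub_const 1).div_const s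
    refine (((h1.log hD.ne').neg.div_const (2 * (1 + s ^ 2))).add
      (h2.arctan.const_mul (s / (1 + s ^ 2)))).congr_deriv ?_
    have h3 : 1 + (((1 + s ^ 2) * t - 1) / s) ^ 2
        = (1 + s ^ 2) * ((1 - t) ^ 2 + s ^ 2 * t ^ 2) / s ^ 2 := by
      field_simp
      ring
    rw [h3, dilogKernel]
    field_simp
    ring
  rw [intervalIntegral.integral_eq_sub_of_hasDerivAt key
    (continuous_dilogKernel_right hs).continuousOn.intervalIntegrable]
  have e1 : ((1 + s ^ 2) * 1 - 1) / s = s := by field_simp; ring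
  have e2 : ((1 + s ^ 2) * 0 - 1) / s = -s⁻¹ := by field_simp; ring
  rw [e1, e2, Real.arctan_neg, Real.arctan_inv_of_pos hs]
  simp
  field_simp
  ring

lemma integral_dilogKernel_left {a t : ℝ} (ht0 : 0 < t) (ht1 : t < 1) :
    ∫ s in (0:ℝ)..a, dilogKernel s t = Real.arctan (a * t / (1 - t)) / t := by
  have h1t : 0 < 1 - t := sub_pos.2 ht1
  have key : ∀ s ∈ Set.uIcc (0:ℝ) a, HasDerivAt
      (fun s => Real.arctan (s * t / (1 - t)) / t) (dilogKernel s t) s := by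
    intro s _
    have h2 : HasDerivAt (fun s : ℝ => s * t / (1 - t)) (t / (1 - t)) s := by
      simpa using ((hasDerivAt_id s).mul_const t).div_const (1 - t)
    refine (h2.arctan.div_const t).congr_deriv ?_
    have h3 : 1 + (s * t / (1 - t)) ^ 2 = ((1 - t) ^ 2 + s ^ 2 * t ^ 2) / (1 - t) ^ 2 := by
      field_simp
    have : 0 < (1 - t) ^ 2 + s ^ 2 * t ^ 2 := by positivity
    rw [h3, dilogKernel]
    field_simp
  rw [intervalIntegral.integral_eq_sub_of_hasDerivAt key]
  · simp
  · apply Continuous.intervalIntegrable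
    unfold dilogKernel
    refine Continuous.div (by fun_prop) (by fun_prop) fun s => ?_
    positivity

lemma abs_arctan_div_self_le_one (x : ℝ) : |Real.arctan x / x| ≤ 1 := by
  have pos : ∀ y : ℝ, 0 < y → |Real.arctan y / y| ≤ 1 := by
    intro y hy
    have h0 := Real.arctan_pos.2 hy
    rw [abs_of_pos (by positivity), div_le_one hy]
    have := Real.lt_tan h0 (Real.arctan_lt_pi_div_two y)
    rw [Real.tan_arctan] at this
    exact this.le
  rcases lt_trichotomy x 0 with h | rfl | h
  · simpa [Real.arctan_neg] using pos (-x) (neg_pos.2 h)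
  · simp
  · exact pos x h

lemma intervalIntegrable_arctan_div_self (a b : ℝ) :
    IntervalIntegrable (fun x => Real.arctan x / x) MeasureTheory.volume a b := by
  rw [intervalIntegrable_iff]
  refine MeasureTheory.Measure.integrableOn_of_bounded (M := 1) (by simp) ?_ ?_
  · exact Measurable.aestronglyMeasurable (by fun_prop)
  · exact Filter.Eventually.of_forall fun x => abs_arctan_div_self_le_one x

lemma continuous_Ti2 : Continuous Ti2 :=
  intervalIntegral.continuous_primitive intervalIntegrable_arctan_div_self 0

lemma hasDerivAt_Ti2 {x : ℝ} (hx : 0 < x) : HasDerivAt Ti2 (Real.arctan x / x) x := by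
  refine intervalIntegral.integral_hasDerivAt_right (intervalIntegrable_arctan_div_self 0 x) ?_ ?_
  · exact Measurable.stronglyMeasurable (by fun_prop) |>.stronglyMeasurableAtFilter
  · exact Real.continuous_arctan.continuousAt.div continuousAt_id hx.ne'

lemma continuous_arctan_mul_log : Continuous fun x => Real.arctan x * Real.log x := by
  rw [continuous_iff_continuousAt]
  intro x
  rcases eq_or_ne x 0 with rfl | hx
  · have h : Filter.Tendsto (fun x : ℝ => |x * Real.log x|) (nhds 0) (nhds 0) := by
      simpa using (Real.continuous_mul_log.abs).tendsto 0
    rw [ContinuousAt, Real.arctan_zero, zero_mul]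
    refine squeeze_zero_norm (fun y => ?_) h
    rw [Real.norm_eq_abs, abs_mul, abs_mul]
    refine mul_le_mul_of_nonneg_right ?_ (abs_nonneg _)
    rcases eq_or_ne y 0 with rfl | hy
    · simp
    · have := abs_arctan_div_self_le_one y
      rwa [abs_div, div_le_one (abs_pos.2 hy)] at this
  · exact Real.continuous_arctan.continuousAt.mul (Real.continuousAt_log hx)

lemma intervalIntegrable_log_kernel (a : ℝ) : IntervalIntegrable
    (fun s => (π / 2 * s - Real.log s) / (1 + s ^ 2)) MeasureTheory.volume 0 a := by
  simp_rw [div_eq_mul_inv]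
  refine IntervalIntegrable.mul_continuousOn ?_ ?_
  · exact (Continuous.intervalIntegrable (by fun_prop) _ _).sub
      intervalIntegral.intervalIntegrable_log'
  · exact Continuous.continuousOn (Continuous.inv₀ (by fun_prop) fun s => by positivity)

lemma integral_log_kernel {a : ℝ} (ha : 0 < a) :
    ∫ s in (0:ℝ)..a, (π / 2 * s - Real.log s) / (1 + s ^ 2)
      = Ti2 a - Real.arctan a * Real.log a + π / 4 * Real.log (a ^ 2 + 1) := by
  have hlog : Continuous fun s : ℝ => Real.log (s ^ 2 + 1) :=
    Continuous.log (by fun_prop) fun s => by positivity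
  rw [intervalIntegral.integral_eq_sub_of_hasDerivAt_of_le
    (f := fun s => Ti2 s - Real.arctan s * Real.log s + π / 4 * Real.log (s ^ 2 + 1)) ha.le
    ((continuous_Ti2.sub continuous_arctan_mul_log).add (hlog.const_mul _)).continuousOn ?_
    (intervalIntegrable_log_kernel a)]
  · simp [Ti2]
  · intro s hs
    have hs0 : 0 < s := hs.1
    have h1 : HasDerivAt (fun s : ℝ => s ^ 2 + 1) (2 * s) s := by
      simpa using ((hasDerivAt_id s).pow 2).add_const 1
    refine (((hasDerivAt_Ti2 hs0).sub
      ((Real.hasDerivAt_arctan s).mul (Real.hasDerivAt_log hs0.ne'))).add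
      ((h1.log (by positivity)).const_mul (π / 4))).congr_deriv ?_
    field_simp
    ring

lemma integrable_dilogKernel (a : ℝ) :
    MeasureTheory.Integrable (Function.uncurry dilogKernel)
      ((MeasureTheory.volume.restrict (Set.Ioc 0 a)).prod
        (MeasureTheory.volume.restrict (Set.Ioc 0 1))) := by
  rw [MeasureTheory.integrable_prod_iff measurable_dilogKernel.aestronglyMeasurable]
  constructor
  · filter_upwards [MeasureTheory.ae_restrict_mem measurableSet_Ioc] with s hs
    exact ((continuous_dilogKernel_right hs.1).intervalIntegrable 0 1).1
  · refine (intervalIntegrable_log_kernel a).1.congr ?_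
    filter_upwards [MeasureTheory.ae_restrict_mem measurableSet_Ioc] with s hs
    rw [← integral_dilogKernel_right hs.1, intervalIntegral.integral_of_le zero_le_one]
    refine MeasureTheory.setIntegral_congr_fun measurableSet_Ioc fun t ht => ?_
    have : 0 ≤ dilogKernel s t :=
      div_nonneg (sub_nonneg.2 ht.2) (dilogKernel_denom_pos hs.1 t).le
    simp [abs_of_nonneg this]

lemma integral_arctan_mul_div {a : ℝ} (ha : 0 < a) :
    ∫ t in (0:ℝ)..1, Real.arctan (a * t / (1 - t)) / t
      = Ti2 a - Real.arctan a * Real.log a + π / 4 * Real.log (a ^ 2 + 1) := by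
  have h1 : ∫ t in (0:ℝ)..1, Real.arctan (a * t / (1 - t)) / t
      = ∫ t in (0:ℝ)..1, ∫ s in (0:ℝ)..a, dilogKernel s t := by
    refine intervalIntegral.integral_congr_ae ?_
    filter_upwards [MeasureTheory.Measure.ae_ne MeasureTheory.volume (1:ℝ)] with t ht1 ht
    rw [Set.uIoc_of_le zero_le_one] at ht
    exact (integral_dilogKernel_left ht.1 (lt_of_le_of_ne ht.2 ht1)).symm
  have h2 : ∫ s in (0:ℝ)..a, (π / 2 * s - Real.log s) / (1 + s ^ 2)
      = ∫ s in (0:ℝ)..a, ∫ t in (0:ℝ)..1, dilogKernel s t := by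
    simp only [intervalIntegral.integral_of_le ha.le]
    exact MeasureTheory.setIntegral_congr_fun measurableSet_Ioc fun s hs =>
      (integral_dilogKernel_right hs.1).symm
  rw [← integral_log_kernel ha, h1, h2]
  simp only [intervalIntegral.integral_of_le ha.le, intervalIntegral.integral_of_le zero_le_one]
  exact (MeasureTheory.integral_integral_swap (integrable_dilogKernel a)).symm

lemma Complex.arg_eq_arctan_of_re_pos {z : ℂ} (hz : 0 < z.re) :
    z.arg = Real.arctan (z.im / z.re) := by
  have h := abs_lt.1 (Complex.abs_arg_lt_pi_div_two_iff.2 (Or.inl hz))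
  rw [← Complex.tan_arg, Real.arctan_tan h.1 h.2]

lemma im_log_one_sub_div {a t : ℝ} (ht1 : t < 1) :
    (Complex.log (1 - (1 + Complex.I * (a : ℂ)) * (t : ℂ)) / (t : ℂ)).im
      = -(Real.arctan (a * t / (1 - t)) / t) := by
  have hre : (1 - (1 + Complex.I * (a : ℂ)) * (t : ℂ)).re = 1 - t := by simp
  have him : (1 - (1 + Complex.I * (a : ℂ)) * (t : ℂ)).im = -(a * t) := by simp
  rw [Complex.div_ofReal_im, Complex.log_im, Complex.arg_eq_arctan_of_re_pos (by linarith),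
    hre, him, neg_div, Real.arctan_neg, neg_div]

lemma im_Li2_one_add_I_mul {a : ℝ} (ha : 0 < a) (h : (Li2 (1 + Complex.I * (a : ℂ))).im ≠ 0) :
    (Li2 (1 + Complex.I * (a : ℂ))).im
      = Ti2 a - Real.arctan a * Real.log a + π / 4 * Real.log (a ^ 2 + 1) := by
  have hint : IntervalIntegrable
      (fun t : ℝ => Complex.log (1 - (1 + Complex.I * (a : ℂ)) * (t : ℂ)) / (t : ℂ))
      MeasureTheory.volume 0 1 := by
    by_contra hc
    exact h (by rw [Li2, intervalIntegral.integral_undef hc]; simp)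
  rw [Li2, Complex.neg_im, ← Complex.imCLM_apply,
    ← Complex.imCLM.intervalIntegral_comp_comm hint, ← integral_arctan_mul_div ha,
    ← intervalIntegral.integral_neg]
  refine intervalIntegral.integral_congr_ae ?_
  filter_upwards [MeasureTheory.Measure.ae_ne MeasureTheory.volume (1:ℝ)] with t ht1 ht
  rw [Set.uIoc_of_le zero_le_one] at ht
  rw [Complex.imCLM_apply, im_log_one_sub_div (lt_of_le_of_ne ht.2 ht1), neg_neg]

lemma intervalIntegrable_I_integrand (a b c : ℝ) :
    IntervalIntegrable (fun β => Real.arctan ((a + Real.cos β) / Real.sin β))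
      MeasureTheory.volume b c := by
  rw [intervalIntegrable_iff]
  refine MeasureTheory.Measure.integrableOn_of_bounded (M := π / 2) (by simp) ?_ ?_
  · exact Measurable.aestronglyMeasurable (by fun_prop)
  · exact Filter.Eventually.of_forall fun x =>
      abs_le.2 ⟨(Real.neg_pi_div_two_lt_arctan _).le, (Real.arctan_lt_pi_div_two _).le⟩

lemma intervalIntegrable_phi_integrand (a b c : ℝ) :
    IntervalIntegrable (fun β => Real.arctan ((a + Real.cos β) / Real.sin β) + (β - π / 2))
      MeasureTheory.volume b c :=
  (intervalIntegrable_I_integrand a b c).add (Continuous.intervalIntegrable (by fun_prop) _ _)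

lemma phi_eq_integral (a b : ℝ) : I a b - π * b / 2 + b ^ 2 / 2
    = ∫ β in (0:ℝ)..b, (Real.arctan ((a + Real.cos β) / Real.sin β) + (β - π / 2)) := by
  rw [intervalIntegral.integral_add (intervalIntegrable_I_integrand a 0 b)
    (Continuous.intervalIntegrable (by fun_prop) _ _),
    intervalIntegral.integral_sub (Continuous.intervalIntegrable (by fun_prop) _ _)
    (Continuous.intervalIntegrable (by fun_prop) _ _)]
  simp [I]
  ring

lemma phi_integrand_pos {a β : ℝ} (ha : 0 < a) (h0 : 0 < β) (h1 : β < π) :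
    0 < Real.arctan ((a + Real.cos β) / Real.sin β) + (β - π / 2) := by
  have hs := Real.sin_pos_of_pos_of_lt_pi h0 h1
  have h : Real.tan (π / 2 - β) < (a + Real.cos β) / Real.sin β := by
    rw [Real.tan_eq_sin_div_cos, Real.sin_pi_div_two_sub, Real.cos_pi_div_two_sub]
    gcongr
    linarith
  have h' := Real.arctan_strictMono h
  rw [Real.arctan_tan (by linarith) (by linarith)] at h'
  linarith

lemma continuous_phi (a : ℝ) : Continuous fun b => I a b - π * b / 2 + b ^ 2 / 2 := by
  simp_rw [phi_eq_integral]
  exact intervalIntegral.continuous_primitive (intervalIntegrable_phi_integrand a) 0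

lemma strictMonoOn_phi {a : ℝ} (ha : 0 < a) :
    StrictMonoOn (fun b => I a b - π * b / 2 + b ^ 2 / 2) (Set.Icc 0 π) := by
  intro x hx y hy hxy
  have h := intervalIntegral.intervalIntegral_pos_of_pos_on
    (intervalIntegrable_phi_integrand a x y)
    (fun β hβ => phi_integrand_pos ha (hx.1.trans_lt hβ.1) (hβ.2.trans_le hy.2)) hxy
  rw [← intervalIntegral.integral_interval_sub_left (intervalIntegrable_phi_integrand a 0 y)
    (intervalIntegrable_phi_integrand a 0 x), ← phi_eq_integral, ← phi_eq_integral] at h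
  exact sub_pos.1 h

theorem stmt_6 (a : ℝ) (ha : 0 < a) (L : ℝ)
    (hL : Filter.Tendsto (fun b => I a b - π * b / 2 + b ^ 2 / 2)
      (nhdsWithin π (Set.Iio π)) (nhds L))
    (hψ0 : 0 < (Li2 (1 + Complex.I * (a : ℂ))).im)
    (hψL : (Li2 (1 + Complex.I * (a : ℂ))).im < L) :
    ∃! b, b ∈ Set.Ioo (0:ℝ) π ∧
      Ti2 a = Real.arctan a * Real.log a + I a b - π * b / 2 + b ^ 2 / 2
        - π / 4 * Real.log (a ^ 2 + 1) := by
  have hψ := im_Li2_one_add_I_mul ha hψ0.ne'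
  have hLπ : L = I a π - π * π / 2 + π ^ 2 / 2 :=
    tendsto_nhds_unique hL ((continuous_phi a).tendsto π |>.mono_left nhdsWithin_le_nhds)
  have h0 : I a 0 - π * 0 / 2 + 0 ^ 2 / 2 = 0 := by simp [I]
  obtain ⟨b, hb, hbψ⟩ := intermediate_value_Ioo Real.pi_pos.le (continuous_phi a).continuousOn
    ⟨h0.trans_lt hψ0, hψL.trans_eq hLπ⟩
  simp only at hbψ
  refine ⟨b, ⟨hb, by linarith⟩, fun c ⟨hc, hcψ⟩ => ?_⟩
  refine (strictMonoOn_phi ha).injOn (Set.Ioo_subset_Icc_self hc) (Set.Ioo_subset_Icc_self hb) ?_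
  linarith
end

section
/- The imaginary part of the principal-branch dilogarithm at 1 + i equals Catalan's constant plus (π/4)·log 2; that is, Im(Li₂(1 + i)) = G + (π/4)·log 2, and moreover 0 < Im(Li₂(1 + i)) < π²/4. -/
open scoped Real

/-- Catalan's constant `G = ∫₀¹ arctan(x)/x dx`. -/
noncomputable def G : ℝ := ∫ x in (0:ℝ)..1, Real.arctan x / x

open MeasureTheory Set Topology

theorem intervalIntegrable_inv_smul_of_differentiableAt_zero {E : Type*} [NormedAddCommGroup E]
    [NormedSpace ℝ E] {f : ℝ → E} {s : Set ℝ} {a b : ℝ} (hf0 : f 0 = 0) (hs : s ∈ 𝓝 0)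
    (hab : uIcc a b ⊆ s) (hf : ContinuousOn f s) (hd : DifferentiableAt ℝ f 0) :
    IntervalIntegrable (fun t => t⁻¹ • f t) volume a b := by
  have hc : ContinuousOn (dslope f 0) (uIcc a b) := ((continuousOn_dslope hs).2 ⟨hf, hd⟩).mono hab
  refine hc.intervalIntegrable.congr_ae ?_
  filter_upwards [ae_restrict_of_ae (volume.ae_ne 0)] with t ht
  rw [dslope_of_ne _ ht, slope_def_module, hf0, sub_zero, sub_zero]

theorem intervalIntegrable_arctan_div (a b : ℝ) :
    IntervalIntegrable (fun x => Real.arctan x / x) volume a b := by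
  have := intervalIntegrable_inv_smul_of_differentiableAt_zero (f := Real.arctan) (a := a) (b := b)
    Real.arctan_zero Filter.univ_mem (subset_univ _) Real.continuous_arctan.continuousOn
    (Real.differentiableAt_arctan 0)
  simpa [div_eq_inv_mul] using this

theorem one_sub_one_add_I_mul_mem_slitPlane {t : ℝ} (ht : t ≤ 1) :
    1 - (1 + Complex.I) * (t : ℂ) ∈ Complex.slitPlane := by
  rw [Complex.mem_slitPlane_iff]
  rcases ht.lt_or_eq with h | rfl
  · left; simpa using h
  · right; simp

theorem intervalIntegrable_log_one_sub_div :
    IntervalIntegrable (fun t : ℝ => Complex.log (1 - (1 + Complex.I) * (t : ℂ)) / (t : ℂ))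
      volume 0 1 := by
  have hd (t : ℝ) (ht : t ≤ 1) : DifferentiableAt ℝ
      (fun t : ℝ => Complex.log (1 - (1 + Complex.I) * (t : ℂ))) t := by
    have h := (((Complex.ofRealCLM.hasDerivAt (x := t)).const_mul (1 + Complex.I)).const_sub
      (1 : ℂ)).clog_real (one_sub_one_add_I_mul_mem_slitPlane ht)
    exact h.differentiableAt
  have := intervalIntegrable_inv_smul_of_differentiableAt_zero
    (f := fun t : ℝ => Complex.log (1 - (1 + Complex.I) * (t : ℂ))) (s := Iic 1) (a := 0) (b := 1)
    (by simp) (Iic_mem_nhds one_pos) (by rw [uIcc_of_le zero_le_one]; exact Icc_subset_Iic_self)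
    (fun t ht => (hd t ht).continuousAt.continuousWithinAt) (hd 0 zero_le_one)
  refine this.congr fun t _ => ?_
  simp [div_eq_inv_mul]

theorem log_one_sub_one_add_I_mul_im {t : ℝ} (ht : t < 1) :
    (Complex.log (1 - (1 + Complex.I) * (t : ℂ))).im = -Real.arctan (t / (1 - t)) := by
  have hre : 0 < (1 - (1 + Complex.I) * (t : ℂ)).re := by simpa using ht
  have h := Complex.abs_arg_lt_pi_div_two_iff.2 (Or.inl hre)
  rw [abs_lt] at h
  rw [Complex.log_im, ← Real.arctan_tan h.1 h.2, Complex.tan_arg, ← Real.arctan_neg]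
  simp [neg_div]

theorem arctan_one_sub_div_one_add {x : ℝ} (hx : 0 ≤ x) :
    Real.arctan ((1 - x) / (1 + x)) = π / 4 - Real.arctan x := by
  have hx' : 0 < 1 + x := by linarith
  have hlt : x * ((1 - x) / (1 + x)) < 1 := by
    rw [← mul_div_assoc, div_lt_one hx']; nlinarith [sq_nonneg x]
  have hne : 1 - x * ((1 - x) / (1 + x)) ≠ 0 := by linarith
  have h := Real.arctan_add hlt
  have h1 : (x + (1 - x) / (1 + x)) / (1 - x * ((1 - x) / (1 + x))) = 1 := by
    rw [div_eq_one_iff_eq hne]; field_simp; ring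
  rw [h1, Real.arctan_one] at h
  linarith

theorem intervalIntegrable_arctan_div_one_add :
    IntervalIntegrable (fun x => Real.arctan x / (1 + x)) volume 0 1 := by
  refine ContinuousOn.intervalIntegrable ?_
  rw [uIcc_of_le zero_le_one]
  refine Real.continuous_arctan.continuousOn.div (by fun_prop) fun x hx => ?_
  linarith [hx.1]

theorem integral_arctan_div_one_add :
    ∫ x in (0:ℝ)..1, Real.arctan x / (1 + x) = π / 8 * Real.log 2 := by
  have hsub := intervalIntegral.integral_comp_mul_deriv_of_deriv_nonpos (a := 0) (b := 1)
    (f := fun x : ℝ => (1 - x) / (1 + x)) (f' := fun x => -2 / (1 + x) ^ 2)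
    (g := fun x => Real.arctan x / (1 + x)) ?_ ?_ ?_
  · have hlog : ∫ x in (0:ℝ)..1, (1 + x)⁻¹ = Real.log 2 := by
      rw [intervalIntegral.integral_comp_add_left (fun x : ℝ => x⁻¹),
        integral_inv_of_pos (by norm_num) (by norm_num)]
      norm_num
    have hint : IntervalIntegrable (fun x : ℝ => π / 4 * (1 + x)⁻¹) volume 0 1 := by
      refine ContinuousOn.intervalIntegrable ?_
      rw [uIcc_of_le zero_le_one]
      refine continuousOn_const.mul (ContinuousOn.inv₀ (by fun_prop) fun x hx => ?_)
      linarith [hx.1]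
    have hcongr : ∫ x in (0:ℝ)..1, ((fun x => Real.arctan x / (1 + x)) ∘
          fun x : ℝ => (1 - x) / (1 + x)) x * (-2 / (1 + x) ^ 2) =
        ∫ x in (0:ℝ)..1, (Real.arctan x / (1 + x) - π / 4 * (1 + x)⁻¹) := by
      refine intervalIntegral.integral_congr_Ioo_of_le zero_le_one fun x hx => ?_
      have : 1 + x ≠ 0 := by linarith [hx.1]
      have h2 : 1 + (1 - x) / (1 + x) = 2 / (1 + x) := by field_simp; ring
      simp only [Function.comp, arctan_one_sub_div_one_add hx.1.le, h2]
      field_simp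
      ring
    rw [hcongr, intervalIntegral.integral_sub intervalIntegrable_arctan_div_one_add hint,
      intervalIntegral.integral_const_mul, hlog] at hsub
    norm_num at hsub
    rw [intervalIntegral.integral_symm 0 1] at hsub
    linarith
  · rw [uIcc_of_le zero_le_one]
    refine ContinuousOn.div (by fun_prop) (by fun_prop) fun x hx => ?_
    linarith [hx.1]
  · intro x hx
    rw [min_eq_left zero_le_one] at hx
    have : 1 + x ≠ 0 := by linarith [hx.1]
    refine (((hasDerivAt_id' x).const_sub 1).fun_div
      ((hasDerivAt_id' x).const_add 1) this).congr_deriv ?_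
    ring
  · intro x _
    exact div_nonpos_of_nonpos_of_nonneg (by norm_num) (sq_nonneg _)

theorem hasDerivAt_div_one_sub {t : ℝ} (ht : t < 1) :
    HasDerivAt (fun t : ℝ => t / (1 - t)) (1 / (1 - t) ^ 2) t := by
  refine ((hasDerivAt_id' t).fun_div ((hasDerivAt_id' t).const_sub 1)
    (sub_ne_zero.2 ht.ne')).congr_deriv ?_
  ring

theorem hasDerivAt_arctan_div_one_sub {t : ℝ} (ht : t < 1) :
    HasDerivAt (fun t : ℝ => Real.arctan (t / (1 - t)))
      (1 / (1 + (t / (1 - t)) ^ 2) * (1 / (1 - t) ^ 2)) t :=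
  (hasDerivAt_div_one_sub ht).arctan

theorem integral_arctan_div_one_sub_mul :
    ∫ t in (0:ℝ)..1 / 2, (Real.arctan (t / (1 - t)) / t - Real.arctan (t / (1 - t)) / (1 - t)) =
      G - π / 4 * Real.log 2 := by
  have hsub := intervalIntegral.integral_comp_mul_deriv_of_deriv_nonneg (a := 0) (b := 1 / 2)
    (f := fun t : ℝ => t / (1 - t)) (f' := fun t => 1 / (1 - t) ^ 2)
    (g := fun x => Real.arctan x / x - 2 * (Real.arctan x / (1 + x))) ?_ ?_ ?_
  · have hcongr : ∫ t in (0:ℝ)..1 / 2,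
          (Real.arctan (t / (1 - t)) / t - Real.arctan (t / (1 - t)) / (1 - t)) =
        ∫ t in (0:ℝ)..1 / 2, ((fun x => Real.arctan x / x - 2 * (Real.arctan x / (1 + x))) ∘
          fun t : ℝ => t / (1 - t)) t * (1 / (1 - t) ^ 2) := by
      refine intervalIntegral.integral_congr_Ioo_of_le (by norm_num) fun t ht => ?_
      have h0 : t ≠ 0 := ht.1.ne'
      have h1 : 1 - t ≠ 0 := by linarith [ht.2]
      have h2 : 1 + t / (1 - t) = 1 / (1 - t) := by field_simp; ring
      simp only [Function.comp, h2]
      field_simp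
      ring
    rw [hcongr, hsub]
    norm_num
    rw [intervalIntegral.integral_sub (intervalIntegrable_arctan_div 0 1)
      (intervalIntegrable_arctan_div_one_add.const_mul 2), intervalIntegral.integral_const_mul,
      integral_arctan_div_one_add, G]
    ring
  · rw [uIcc_of_le (by norm_num)]
    intro t ht
    exact (hasDerivAt_div_one_sub (by linarith [ht.2])).continuousAt.continuousWithinAt
  · rw [min_eq_left (by norm_num), max_eq_right (by norm_num)]
    intro t ht
    exact hasDerivAt_div_one_sub (by linarith [ht.2])
  · intro t _
    positivity

theorem Li2_one_add_I_im : (Li2 (1 + Complex.I)).im = G + π / 4 * Real.log 2 := by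
  set F : ℝ → ℂ := fun t => Complex.log (1 - (1 + Complex.I) * (t : ℂ)) / (t : ℂ) with hF
  set θ : ℝ → ℝ := fun t => Real.arctan (t / (1 - t)) with hθ
  have hFint : IntervalIntegrable F volume 0 1 := intervalIntegrable_log_one_sub_div
  have him : ∫ t in (0:ℝ)..1, (F t).im = (∫ t in (0:ℝ)..1, F t).im :=
    intervalIntegral.intervalIntegral_im hFint
  have himF (t : ℝ) (ht : t < 1) : (F t).im = -(θ t / t) := by
    rw [hF, hθ]
    simp only [Complex.div_ofReal_im, log_one_sub_one_add_I_mul_im ht, neg_div]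
  have hFim : IntervalIntegrable (fun t => (F t).im) volume 0 1 :=
    ⟨hFint.1.im, hFint.2.im⟩
  have hhalf : (1 / 2 : ℝ) ∈ uIcc (0:ℝ) 1 := by rw [uIcc_of_le zero_le_one]; norm_num
  have hsplit := intervalIntegral.integral_add_adjacent_intervals
    (hFim.mono_set (uIcc_subset_uIcc left_mem_uIcc hhalf))
    (hFim.mono_set (uIcc_subset_uIcc hhalf right_mem_uIcc))
  have hθc : ContinuousOn θ (Iio 1) := fun t ht =>
    (hasDerivAt_arctan_div_one_sub ht).continuousAt.continuousWithinAt
  have hsubset : uIcc (0:ℝ) (1 / 2) ⊆ Iio 1 := by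
    rw [uIcc_of_le (by norm_num)]
    exact fun t ht => lt_of_le_of_lt ht.2 (by norm_num)
  have hi1 : IntervalIntegrable (fun t => θ t / t) volume 0 (1 / 2) := by
    have := intervalIntegrable_inv_smul_of_differentiableAt_zero (f := θ) (by simp [hθ])
      (Iio_mem_nhds one_pos) hsubset hθc (hasDerivAt_arctan_div_one_sub one_pos).differentiableAt
    simpa [div_eq_inv_mul] using this
  have hne (t : ℝ) (ht : t ∈ uIcc (0:ℝ) (1 / 2)) : 1 - t ≠ 0 := sub_ne_zero.2 (hsubset ht).ne'
  have hi2 : IntervalIntegrable (fun t => θ t / (1 - t)) volume 0 (1 / 2) :=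
    ((hθc.mono hsubset).div (by fun_prop) hne).intervalIntegrable
  have hi3 : IntervalIntegrable (fun t : ℝ => π / 2 * (1 - t)⁻¹) volume 0 (1 / 2) :=
    (continuousOn_const.mul (ContinuousOn.inv₀ (by fun_prop) hne)).intervalIntegrable
  have hleft : ∫ t in (0:ℝ)..1 / 2, (F t).im = -∫ t in (0:ℝ)..1 / 2, θ t / t := by
    rw [← intervalIntegral.integral_neg]
    exact intervalIntegral.integral_congr_Ioo_of_le (by norm_num)
      fun t ht => himF t (by linarith [ht.2])
  have hlog : ∫ t in (0:ℝ)..1 / 2, (1 - t)⁻¹ = Real.log 2 := by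
    rw [intervalIntegral.integral_comp_sub_left (fun x : ℝ => x⁻¹),
      integral_inv_of_pos (by norm_num) (by norm_num)]
    norm_num
  have hright : ∫ t in (1 / 2 : ℝ)..1, (F t).im =
      (∫ t in (0:ℝ)..1 / 2, θ t / (1 - t)) - π / 2 * Real.log 2 := by
    have hrefl := intervalIntegral.integral_comp_sub_left (a := 0) (b := 1 / 2)
      (fun t => (F t).im) 1
    rw [show (1:ℝ) - 1 / 2 = 1 / 2 by norm_num, sub_zero] at hrefl
    rw [← hrefl, ← hlog, ← intervalIntegral.integral_const_mul,
      ← intervalIntegral.integral_sub hi2 hi3]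
    refine intervalIntegral.integral_congr_Ioo_of_le (by norm_num) fun t ht => ?_
    have h1 : 0 < 1 - t := by linarith [ht.2]
    have h : θ (1 - t) = π / 2 - θ t := by
      rw [hθ]
      simp only [sub_sub_cancel]
      rw [← Real.arctan_inv_of_pos (div_pos ht.1 h1), inv_div]
    simp only [himF (1 - t) (by linarith [ht.1]), h]
    ring
  have hmain := integral_arctan_div_one_sub_mul
  rw [intervalIntegral.integral_sub hi1 hi2] at hmain
  rw [Li2, Complex.neg_im, ← him, ← hsplit, hleft, hright]
  linarith

theorem G_nonneg : 0 ≤ G :=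
  intervalIntegral.integral_nonneg zero_le_one fun _ hx =>
    div_nonneg (Real.arctan_nonneg.2 hx.1) hx.1

theorem G_le_one : G ≤ 1 := by
  have h : G ≤ ∫ _ in (0:ℝ)..1, (1:ℝ) := by
    refine intervalIntegral.integral_mono_on zero_le_one (intervalIntegrable_arctan_div 0 1)
      intervalIntegrable_const fun x hx => div_le_one_of_le₀ ?_ hx.1
    simpa using Real.le_tan (Real.arctan_nonneg.2 hx.1) (Real.arctan_lt_pi_div_two x)
  simpa using h

theorem stmt_8 :
    (Li2 (1 + Complex.I)).im = G + π / 4 * Real.log 2 ∧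
    0 < (Li2 (1 + Complex.I)).im ∧
    (Li2 (1 + Complex.I)).im < π ^ 2 / 4 := by
  refine ⟨Li2_one_add_I_im, ?_, ?_⟩
  · rw [Li2_one_add_I_im]
    have := G_nonneg
    have := Real.log_pos one_lt_two
    positivity
  · rw [Li2_one_add_I_im]
    nlinarith [G_le_one, Real.log_two_lt_d9, Real.pi_gt_three]
end
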